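/- Let d, m ≥ 1, α ∈ ℂ, ζ_m = e^{2πi/m}, and define Ψ(0,m,d;α) = (1/m) Σ_{j=0}^{m−1} (ζ_m^{−j} x² + α x y + ζ_m^{j} y²)^d ∈ ℂ[x,y]. (i) If m > d, then Ψ(0,m,d;α) = (Σ_{r=0}^{⌊d/2⌋} d!/((r!)² (d−2r)!) · α^{d−2r}) · x^d y^d. (ii) If 2m > d ≥ m, then Ψ(0,m,d;α) = (Σ_{r=0}^{⌊d/2⌋} d!/((r!)² (d−2r)!) · α^{d−2r}) · x^d y^d + (Σ_{r=0}^{⌊(d−m)/2⌋} d!/(r! (r+m)! (d−m−2r)!) · α^{d−m−2r}) · (x^{d+m} y^{d−m} + x^{d−m} y^{d+m}). -/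

import Mathlib

open MvPolynomial Finset

/-- The variable `x` in `ℂ[x,y]`. -/
noncomputable def Px : MvPolynomial (Fin 2) ℂ := MvPolynomial.X 0

/-- The variable `y` in `ℂ[x,y]`. -/
noncomputable def Py : MvPolynomial (Fin 2) ℂ := MvPolynomial.X 1

/-- `Ψ(0,m,d;α) = (1/m) Σ_{j=0}^{m−1} (ζ_m^{−j} x² + α x y + ζ_m^{j} y²)^d`,
where `ζ_m = e^{2πi/m}`. -/
noncomputable def Psi (m d : ℕ) (α : ℂ) : MvPolynomial (Fin 2) ℂ :=
  C ((1 : ℂ) / m) *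
    ∑ j ∈ Finset.range m,
      (C ((Complex.exp (2 * (Real.pi : ℂ) * Complex.I / (m : ℂ)))⁻¹ ^ j) * Px ^ 2 +
       C α * Px * Py +
       C ((Complex.exp (2 * (Real.pi : ℂ) * Complex.I / (m : ℂ))) ^ j) * Py ^ 2) ^ d

/-- The trinomial theorem, with the middle term singled out. -/
theorem trinomial_pow {R : Type*} [CommRing R] [Algebra ℂ R] (d : ℕ) (A B D : R) :
    (A + B + D) ^ d = ∑ s ∈ Finset.range (d + 1), ∑ p ∈ antidiagonal s,
      algebraMap ℂ R ((d.factorial : ℂ) /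
        ((p.1.factorial : ℂ) * (p.2.factorial : ℂ) * ((d - s).factorial : ℂ))) *
        (A ^ p.1 * D ^ p.2 * B ^ (d - s)) := by
  rw [show A + B + D = (A + D) + B by ring, add_pow]
  refine Finset.sum_congr rfl fun s hs => ?_
  have hs' : s ≤ d := by simpa [Nat.lt_succ_iff] using hs
  rw [(Commute.all A D).add_pow', Finset.sum_mul, Finset.sum_mul]
  refine Finset.sum_congr rfl fun p hp => ?_
  obtain ⟨a, b⟩ := p
  obtain rfl : a + b = s := by simpa using hp
  have key : (d.factorial : ℂ) /
      ((a.factorial : ℂ) * (b.factorial : ℂ) * ((d - (a + b)).factorial : ℂ)) =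
      (((a + b).choose a * d.choose (a + b) : ℕ) : ℂ) := by
    have h1 := Nat.choose_mul_factorial_mul_factorial hs'
    have h2 := Nat.choose_mul_factorial_mul_factorial (Nat.le_add_right a b)
    rw [Nat.add_sub_cancel_left] at h2
    have ha : (a.factorial : ℂ) ≠ 0 := by exact_mod_cast a.factorial_ne_zero
    have hb : (b.factorial : ℂ) ≠ 0 := by exact_mod_cast b.factorial_ne_zero
    have hc : ((d - (a + b)).factorial : ℂ) ≠ 0 := by
      exact_mod_cast (d - (a + b)).factorial_ne_zero
    rw [div_eq_iff (by positivity), ← h1, ← h2]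
    push_cast
    ring
  dsimp only
  rw [key, map_natCast, nsmul_eq_mul]
  push_cast
  ring

/-- Averaging `ζ^(j(b-a))` over `j` detects the congruence `a ≡ b` modulo `m`. -/
theorem IsPrimitiveRoot.sum_inv_pow_mul_pow {m : ℕ} {ζ : ℂ} (hζ : IsPrimitiveRoot ζ m)
    (hm : m ≠ 0) (a b : ℕ) :
    ∑ j ∈ Finset.range m, (ζ⁻¹ ^ j) ^ a * (ζ ^ j) ^ b = if a ≡ b [MOD m] then (m : ℂ) else 0 := by
  have h0 : ζ ≠ 0 := hζ.ne_zero hm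
  have hw : ∀ j, (ζ⁻¹ ^ j) ^ a * (ζ ^ j) ^ b = (ζ⁻¹ ^ a * ζ ^ b) ^ j := fun j => by
    rw [mul_pow, ← pow_mul, ← pow_mul, ← pow_mul, ← pow_mul, mul_comm j a, mul_comm j b]
  have hiff : ζ⁻¹ ^ a * ζ ^ b = 1 ↔ a ≡ b [MOD m] := by
    rw [inv_pow, inv_mul_eq_one₀ (pow_ne_zero _ h0), hζ.eq_orderOf]
    exact (hζ.isOfFinOrder hm).pow_eq_pow_iff_modEq
  simp_rw [hw]
  split_ifs with h
  · rw [hiff.2 h]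
    simp
  · have hne : ζ⁻¹ ^ a * ζ ^ b - 1 ≠ 0 := sub_ne_zero.2 (mt hiff.1 h)
    have hone : (ζ⁻¹ ^ a * ζ ^ b) ^ m = 1 := by
      rw [mul_pow, ← pow_mul, ← pow_mul, mul_comm a, mul_comm b, pow_mul, pow_mul, inv_pow,
        hζ.pow_eq_one]
      simp
    have hgeom := geom_sum_mul (ζ⁻¹ ^ a * ζ ^ b) m
    rw [hone, sub_self] at hgeom
    exact (mul_eq_zero.1 hgeom).resolve_right hne

/-- The part of a sum over `a + b ≤ d` supported on the line `b = a + k`. -/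
theorem sum_antidiagonal_ite_snd {M : Type*} [AddCommMonoid M] (d k : ℕ) (hk : k ≤ d)
    (f : ℕ → ℕ → M) :
    ∑ s ∈ Finset.range (d + 1), ∑ p ∈ antidiagonal s,
      (if p.2 = p.1 + k then f p.1 p.2 else 0) =
    ∑ r ∈ Finset.range ((d - k) / 2 + 1), f r (r + k) := by
  rw [Finset.sum_sigma', ← Finset.sum_filter]
  refine Finset.sum_nbij' (fun x => x.2.1) (fun r => ⟨2 * r + k, (r, r + k)⟩) ?_ ?_ ?_ ?_ ?_
  · rintro ⟨s, a, b⟩ h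
    simp only [mem_filter, mem_sigma, Finset.mem_range, HasAntidiagonal.mem_antidiagonal] at h ⊢
    omega
  · intro r h
    simp only [mem_filter, mem_sigma, Finset.mem_range, HasAntidiagonal.mem_antidiagonal,
      and_true] at h ⊢
    omega
  · rintro ⟨s, a, b⟩ h
    simp only [mem_filter, mem_sigma, Finset.mem_range, HasAntidiagonal.mem_antidiagonal] at h
    obtain ⟨⟨-, rfl⟩, rfl⟩ := h
    simp only [Sigma.mk.injEq, heq_eq_eq, and_true]
    omega
  · intro r _
    rfl
  · rintro ⟨s, a, b⟩ h
    simp only [mem_filter] at h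
    simp only [h.2]

/-- The part of a sum over `a + b ≤ d` supported on the line `a = b + k`. -/
theorem sum_antidiagonal_ite_fst {M : Type*} [AddCommMonoid M] (d k : ℕ) (hk : k ≤ d)
    (f : ℕ → ℕ → M) :
    ∑ s ∈ Finset.range (d + 1), ∑ p ∈ antidiagonal s,
      (if p.1 = p.2 + k then f p.1 p.2 else 0) =
    ∑ r ∈ Finset.range ((d - k) / 2 + 1), f (r + k) r := by
  rw [← sum_antidiagonal_ite_snd d k hk fun a b => f b a]
  refine Finset.sum_congr rfl fun s _ => ?_
  exact (Finset.Nat.sum_antidiagonal_swap (n := s)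
    (f := fun p => if p.1 = p.2 + k then f p.1 p.2 else 0)).symm

/-- The contribution of the exponents `(a, b)` of `x²` and `y²` to the expansion of
`(x² + α x y + y²)^d`. -/
noncomputable def trinomialTerm (d : ℕ) (α : ℂ) (a b : ℕ) : MvPolynomial (Fin 2) ℂ :=
  C ((d.factorial : ℂ) /
      ((a.factorial : ℂ) * (b.factorial : ℂ) * ((d - (a + b)).factorial : ℂ)) *
        α ^ (d - (a + b))) * (Px ^ (d + a - b) * Py ^ (d + b - a))

/-- `Ψ(0,m,d;α)` collects the terms of the trinomial expansion with `a ≡ b` modulo `m`. -/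
theorem Psi_eq_sum_modEq (m d : ℕ) (hm : m ≠ 0) (α : ℂ) :
    Psi m d α = ∑ s ∈ Finset.range (d + 1), ∑ p ∈ antidiagonal s,
      if p.1 ≡ p.2 [MOD m] then trinomialTerm d α p.1 p.2 else 0 := by
  have hζ := Complex.isPrimitiveRoot_exp m hm
  unfold Psi
  set ζ := Complex.exp (2 * (Real.pi : ℂ) * Complex.I / (m : ℂ))
  have hm' : (m : ℂ) ≠ 0 := Nat.cast_ne_zero.2 hm
  simp_rw [trinomial_pow]
  rw [Finset.sum_comm, Finset.mul_sum]
  refine Finset.sum_congr rfl fun s hs => ?_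
  rw [Finset.sum_comm, Finset.mul_sum]
  refine Finset.sum_congr rfl fun p hp => ?_
  obtain ⟨a, b⟩ := p
  obtain rfl : a + b = s := by simpa using hp
  have hs' : a + b ≤ d := by simpa [Nat.lt_succ_iff] using hs
  have hterm : ∀ j, algebraMap ℂ (MvPolynomial (Fin 2) ℂ) ((d.factorial : ℂ) /
        ((a.factorial : ℂ) * (b.factorial : ℂ) * ((d - (a + b)).factorial : ℂ))) *
      ((C (ζ⁻¹ ^ j) * Px ^ 2) ^ a * (C (ζ ^ j) * Py ^ 2) ^ b *
        (C α * Px * Py) ^ (d - (a + b))) =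
      C ((ζ⁻¹ ^ j) ^ a * (ζ ^ j) ^ b) * trinomialTerm d α a b := fun j => by
    obtain ⟨c, rfl⟩ := Nat.exists_eq_add_of_le hs'
    rw [trinomialTerm, show a + b + c - (a + b) = c by omega,
      show a + b + c + a - b = 2 * a + c by omega, show a + b + c + b - a = 2 * b + c by omega,
      MvPolynomial.algebraMap_eq]
    simp only [map_mul, map_pow]
    ring
  dsimp only
  simp_rw [hterm]
  rw [← Finset.sum_mul, ← map_sum, hζ.sum_inv_pow_mul_pow hm, ← mul_assoc, ← map_mul]
  split_ifs
  · rw [one_div_mul_cancel hm', map_one, one_mul]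
  · simp

theorem Nat.modEq_iff_of_add_lt {a b m : ℕ} (h : a + b < 2 * m) :
    a ≡ b [MOD m] ↔ b = a + 0 ∨ b = a + m ∨ a = b + m := by
  constructor
  · intro hab
    rcases le_total a b with hle | hle
    · obtain ⟨c, hc⟩ := (Nat.modEq_iff_dvd' hle).1 hab
      have : c < 2 := by
        by_contra! hc2
        nlinarith [Nat.mul_le_mul_left m hc2, Nat.sub_le b a]
      interval_cases c <;> omega
    · obtain ⟨c, hc⟩ := (Nat.modEq_iff_dvd' hle).1 hab.symm
      have : c < 2 := by
        by_contra! hc2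
        nlinarith [Nat.mul_le_mul_left m hc2, Nat.sub_le a b]
      interval_cases c <;> omega
  · rintro (rfl | rfl | rfl) <;> simp [Nat.ModEq]

theorem sum_trinomialTerm_diag (d : ℕ) (α : ℂ) :
    ∑ r ∈ Finset.range ((d - 0) / 2 + 1), trinomialTerm d α r (r + 0) =
      C (∑ r ∈ Finset.range (d / 2 + 1),
        (d.factorial : ℂ) / ((r.factorial : ℂ) ^ 2 * ((d - 2 * r).factorial : ℂ)) *
          α ^ (d - 2 * r)) * Px ^ d * Py ^ d := by
  rw [map_sum, mul_assoc, Finset.sum_mul, Nat.sub_zero]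
  refine Finset.sum_congr rfl fun r _ => ?_
  rw [trinomialTerm, add_zero, Nat.add_sub_cancel, ← two_mul, ← sq]

/-- (i) If `m > d`, then
`Ψ(0,m,d;α) = (Σ_{r=0}^{⌊d/2⌋} d!/((r!)²(d−2r)!) α^{d−2r}) x^d y^d`;
(ii) if `2m > d ≥ m`, then `Ψ(0,m,d;α)` equals the same `x^d y^d` term plus
`(Σ_{r=0}^{⌊(d−m)/2⌋} d!/(r!(r+m)!(d−m−2r)!) α^{d−m−2r})(x^{d+m}y^{d−m} + x^{d−m}y^{d+m})`. -/
theorem quadratic_synching (d m : ℕ) (hd : 1 ≤ d) (hm : 1 ≤ m) (α : ℂ) :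
    (m > d →
      Psi m d α =
        C (∑ r ∈ Finset.range (d / 2 + 1),
            (d.factorial : ℂ) / ((r.factorial : ℂ) ^ 2 * ((d - 2 * r).factorial : ℂ)) *
              α ^ (d - 2 * r)) * Px ^ d * Py ^ d) ∧
    (2 * m > d ∧ d ≥ m →
      Psi m d α =
        C (∑ r ∈ Finset.range (d / 2 + 1),
            (d.factorial : ℂ) / ((r.factorial : ℂ) ^ 2 * ((d - 2 * r).factorial : ℂ)) *
              α ^ (d - 2 * r)) * Px ^ d * Py ^ d +
        C (∑ r ∈ Finset.range ((d - m) / 2 + 1),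
            (d.factorial : ℂ) /
                ((r.factorial : ℂ) * ((r + m).factorial : ℂ) * ((d - m - 2 * r).factorial : ℂ)) *
              α ^ (d - m - 2 * r)) *
          (Px ^ (d + m) * Py ^ (d - m) + Px ^ (d - m) * Py ^ (d + m))) := by
  have hm0 : m ≠ 0 := by omega
  refine ⟨fun h => ?_, fun ⟨h, hmd⟩ => ?_⟩
  · rw [Psi_eq_sum_modEq m d hm0, ← sum_trinomialTerm_diag,
      ← sum_antidiagonal_ite_snd d 0 (Nat.zero_le d)]
    refine Finset.sum_congr rfl fun s hs => Finset.sum_congr rfl fun p hp => ?_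
    rw [Finset.mem_range] at hs
    rw [HasAntidiagonal.mem_antidiagonal] at hp
    refine if_congr ?_ rfl rfl
    rw [Nat.modEq_iff_of_add_lt (by omega)]
    omega
  · rw [Psi_eq_sum_modEq m d hm0, ← sum_trinomialTerm_diag, mul_add, map_sum, Finset.sum_mul,
      Finset.sum_mul, add_comm (Finset.sum _ _) (Finset.sum _ _)]
    have hfst : ∀ r ∈ Finset.range ((d - m) / 2 + 1),
        C ((d.factorial : ℂ) /
            ((r.factorial : ℂ) * ((r + m).factorial : ℂ) * ((d - m - 2 * r).factorial : ℂ)) *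
              α ^ (d - m - 2 * r)) * (Px ^ (d + m) * Py ^ (d - m)) =
          trinomialTerm d α (r + m) r := fun r _ => by
      rw [trinomialTerm, show d - (r + m + r) = d - m - 2 * r by omega,
        show d + (r + m) - r = d + m by omega, show d + r - (r + m) = d - m by omega,
        mul_comm (r.factorial : ℂ)]
    have hsnd : ∀ r ∈ Finset.range ((d - m) / 2 + 1),
        C ((d.factorial : ℂ) /
            ((r.factorial : ℂ) * ((r + m).factorial : ℂ) * ((d - m - 2 * r).factorial : ℂ)) *
              α ^ (d - m - 2 * r)) * (Px ^ (d - m) * Py ^ (d + m)) =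
          trinomialTerm d α r (r + m) := fun r _ => by
      rw [trinomialTerm, show d - (r + (r + m)) = d - m - 2 * r by omega,
        show d + (r + m) - r = d + m by omega, show d + r - (r + m) = d - m by omega]
    rw [Finset.sum_congr rfl hfst, Finset.sum_congr rfl hsnd,
      ← sum_antidiagonal_ite_snd d 0 (Nat.zero_le d), ← sum_antidiagonal_ite_snd d m hmd,
      ← sum_antidiagonal_ite_fst d m hmd]
    simp_rw [← Finset.sum_add_distrib]
    refine Finset.sum_congr rfl fun s hs => Finset.sum_congr rfl fun p hp => ?_
    rw [Finset.mem_range] at hs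
    rw [HasAntidiagonal.mem_antidiagonal] at hp
    rw [if_congr (Nat.modEq_iff_of_add_lt (by omega)) rfl rfl]
    by_cases h0 : p.2 = p.1 + 0
    · rw [if_pos (Or.inl h0), if_pos h0, if_neg (by omega), if_neg (by omega)]
      simp
    · by_cases h1 : p.2 = p.1 + m
      · rw [if_pos (Or.inr (Or.inl h1)), if_neg h0, if_pos h1, if_neg (by omega)]
        simp
      · by_cases h2 : p.1 = p.2 + m
        · rw [if_pos (Or.inr (Or.inr h2)), if_neg h0, if_neg h1, if_pos h2]
          simp
        · rw [if_neg (by tauto), if_neg h0, if_neg h1, if_neg h2]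
          simp
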